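/- arXiv:2512.14979 — 2 statements merged into one kernel-verified Lean document; each statement's English description precedes it below -/
import Mathlib

section
/- Under the standing stochastic setup extended to all k ∈ ℕ, suppose the sampled Armijo condition holds almost surely at every iteration k, suppose there is a constant C > 0 and deterministic integers J(K) ≥ 0 with lim_{K→∞} J(K)/K = 0 such that for every K the number of indices k ∈ {0, …, K−1} with t_k ≠ t_{k−1} (t_{−1} ≜ s) is at most (J(K)+1) C almost surely, and suppose the batch sizes satisfy lim_{K→∞} (1/K) Σ_{k=0}^{K−1} 1/N_k = 0. Then lim_{K→∞} (1/K) Σ_{k=0}^{K−1} E[‖G_s(x_k)‖²] = 0, and consequently liminf_{k→∞} E[‖G_s(x_k)‖²] = 0. -/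
open MeasureTheory Filter
open scoped RealInnerProductSpace

section Proximal

variable {E : Type*} [NormedAddCommGroup E] [InnerProductSpace ℝ E]

/-- `p` is a minimizer over `S` of `r y + ‖y - z‖² / (2t)`. -/
def IsProxPoint (S : Set E) (r : E → ℝ) (t : ℝ) (z p : E) : Prop :=
  p ∈ S ∧ ∀ y ∈ S, r p + ‖p - z‖ ^ 2 / (2 * t) ≤ r y + ‖y - z‖ ^ 2 / (2 * t)

variable {S : Set E} {r : E → ℝ} {t : ℝ}

/-- Variational inequality characterizing proximal points. -/
lemma IsProxPoint.inner_le (hr : ConvexOn ℝ S r) (ht : 0 < t) {z p y : E}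
    (hp : IsProxPoint S r t z p) (hy : y ∈ S) : ⟪z - p, y - p⟫ ≤ t * (r y - r p) := by
  have key : ∀ l : ℝ, 0 < l → l ≤ 1 →
      ⟪z - p, y - p⟫ ≤ t * (r y - r p) + l * ‖y - p‖ ^ 2 / 2 := by
    intro l hl hl1
    have h1 := hp.2 _ (hr.1 hp.1 hy (sub_nonneg.2 hl1) hl.le (by ring))
    have h2 := hr.2 hp.1 hy (sub_nonneg.2 hl1) hl.le (by ring)
    have h3 : (1 - l) • p + l • y - z = (p - z) + l • (y - p) := by module
    rw [h3, norm_add_sq_real, inner_smul_right, norm_smul, mul_pow, Real.norm_eq_abs, sq_abs] at h1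
    have h4 : ⟪p - z, y - p⟫ = -⟪z - p, y - p⟫ := by rw [← inner_neg_left, neg_sub]
    rw [h4] at h1
    simp only [smul_eq_mul] at h2
    have h5 : ‖p - z‖ ^ 2 / (2 * t) ≤ l * (r y - r p)
        + (‖p - z‖ ^ 2 + 2 * (l * -⟪z - p, y - p⟫) + l ^ 2 * ‖y - p‖ ^ 2) / (2 * t) := by linarith
    have h6 : l * ⟪z - p, y - p⟫ ≤ l * (t * (r y - r p) + l * ‖y - p‖ ^ 2 / 2) := by
      rw [div_le_iff₀ (by positivity), add_mul, div_mul_cancel₀ _ (by positivity)] at h5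
      linarith
    exact le_of_mul_le_mul_left h6 hl
  by_contra! hlt
  set δ := ⟪z - p, y - p⟫ - t * (r y - r p) with hδ
  have hδ0 : 0 < δ := by linarith
  have hM : 0 ≤ ‖y - p‖ ^ 2 := by positivity
  have h := key (δ / (‖y - p‖ ^ 2 + δ)) (by positivity) (by rw [div_le_one (by positivity)]; linarith)
  have h' : δ ≤ δ * ‖y - p‖ ^ 2 / (‖y - p‖ ^ 2 + δ) / 2 := by
    rw [div_mul_eq_mul_div] at h
    linarith
  have h'' : δ * ‖y - p‖ ^ 2 / (‖y - p‖ ^ 2 + δ) ≤ δ := by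
    rw [div_le_iff₀ (by positivity)]
    nlinarith
  linarith

/-- Proximal points with the same parameter depend nonexpansively on the base point. -/
lemma IsProxPoint.norm_sub_le (hr : ConvexOn ℝ S r) (ht : 0 < t) {z w p q : E}
    (hp : IsProxPoint S r t z p) (hq : IsProxPoint S r t w q) : ‖p - q‖ ≤ ‖z - w‖ := by
  have h1 := hp.inner_le hr ht hq.1
  have h2 := hq.inner_le hr ht hp.1
  have h3 : ⟪z - p, q - p⟫ + ⟪w - q, p - q⟫ = ‖p - q‖ ^ 2 - ⟪z - w, p - q⟫ := by
    rw [← real_inner_self_eq_norm_sq]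
    simp only [inner_sub_left, inner_sub_right]
    rw [real_inner_comm p q]
    ring
  have h4 := real_inner_le_norm (z - w) (p - q)
  have h5 : ‖p - q‖ * ‖p - q‖ ≤ ‖z - w‖ * ‖p - q‖ := by nlinarith
  rcases (norm_nonneg (p - q)).eq_or_lt with h0 | h0
  · rw [← h0]; positivity
  · exact le_of_mul_le_mul_right h5 h0

/-- Dependence of proximal points on the parameter. -/
lemma IsProxPoint.norm_sub_le_of_param (hr : ConvexOn ℝ S r) (ht : 0 < t) {τ : ℝ} (hτ : 0 < τ)
    {z p q : E} (hp : IsProxPoint S r t z p) (hq : IsProxPoint S r τ z q) :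
    ‖p - q‖ ≤ |1 - t / τ| * ‖z - q‖ := by
  have h1 := hp.inner_le hr ht hq.1
  have h2 := hq.inner_le hr hτ hp.1
  have h2' : t / τ * ⟪z - q, p - q⟫ ≤ t * (r p - r q) := by
    calc t / τ * ⟪z - q, p - q⟫ ≤ t / τ * (τ * (r p - r q)) := by gcongr
      _ = t * (r p - r q) := by field_simp
  have h3 : ⟪z - p, q - p⟫ = ‖p - q‖ ^ 2 - ⟪z - q, p - q⟫ := by
    rw [← real_inner_self_eq_norm_sq]
    simp only [inner_sub_left, inner_sub_right]
    rw [real_inner_comm p q]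
    ring
  have h4 := real_inner_le_norm ((1 - t / τ) • (z - q)) (p - q)
  rw [inner_smul_left, norm_smul, Real.norm_eq_abs] at h4
  simp only [conj_trivial] at h4
  have h5 : ‖p - q‖ * ‖p - q‖ ≤ (|1 - t / τ| * ‖z - q‖) * ‖p - q‖ := by nlinarith
  rcases (norm_nonneg (p - q)).eq_or_lt with h0 | h0
  · rw [← h0]; positivity
  · exact le_of_mul_le_mul_right h5 h0

/-- A proximal gradient step moves by at most `t (‖v‖ + Lr)`. -/
lemma IsProxPoint.norm_step_le (hr : ConvexOn ℝ S r) (ht : 0 < t) {Lr : ℝ} (hLr : 0 ≤ Lr)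
    (hlip : ∀ z ∈ S, ∀ w ∈ S, |r z - r w| ≤ Lr * ‖z - w‖) {x v p : E} (hx : x ∈ S)
    (hp : IsProxPoint S r t (x - t • v) p) : ‖x - p‖ ≤ t * (‖v‖ + Lr) := by
  have h1 := hp.inner_le hr ht hx
  have h2 : ⟪x - t • v - p, x - p⟫ = ‖x - p‖ ^ 2 - t * ⟪v, x - p⟫ := by
    rw [show x - t • v - p = (x - p) - t • v by abel, inner_sub_left, real_inner_self_eq_norm_sq,
      inner_smul_left]
    simp
  have h3 := real_inner_le_norm v (x - p)
  have h4 := (le_abs_self _).trans (hlip x hx p hp.1)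
  have h5 : ‖x - p‖ * ‖x - p‖ ≤ (t * (‖v‖ + Lr)) * ‖x - p‖ := by
    have := mul_le_mul_of_nonneg_left h3 ht.le
    have := mul_le_mul_of_nonneg_left h4 ht.le
    nlinarith
  rcases (norm_nonneg (x - p)).eq_or_lt with h0 | h0
  · rw [← h0]; positivity
  · exact le_of_mul_le_mul_right h5 h0

/-- The norm of the gradient mapping is nonincreasing in the step size. -/
lemma IsProxPoint.norm_gradientMapping_anti (hr : ConvexOn ℝ S r) (ht : 0 < t) {s : ℝ}
    (hts : t ≤ s) {x v p q : E} (hp : IsProxPoint S r t (x - t • v) p)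
    (hq : IsProxPoint S r s (x - s • v) q) :
    ‖(1 / s) • (x - q)‖ ≤ ‖(1 / t) • (x - p)‖ := by
  have hs : 0 < s := ht.trans_le hts
  have h1 := hp.inner_le hr ht hq.1
  have h2 := hq.inner_le hr hs hp.1
  set a := (1 / t) • (x - p) with ha
  set b := (1 / s) • (x - q) with hb
  have hxp : p = x - t • a := by rw [ha, smul_smul, mul_one_div_cancel ht.ne', one_smul]; abel
  have hxq : q = x - s • b := by rw [hb, smul_smul, mul_one_div_cancel hs.ne', one_smul]; abel
  have e1 : x - t • v - p = t • (a - v) := by rw [hxp]; module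
  have e2 : x - s • v - q = s • (b - v) := by rw [hxq]; module
  have e3 : q - p = t • a - s • b := by rw [hxp, hxq]; abel
  have e4 : p - q = s • b - t • a := by rw [hxp, hxq]; abel
  rw [e1, inner_smul_left] at h1
  rw [e2, inner_smul_left] at h2
  have h1' : ⟪a - v, q - p⟫ ≤ r q - r p := le_of_mul_le_mul_left h1 ht
  have h2' : ⟪b - v, p - q⟫ ≤ r p - r q := le_of_mul_le_mul_left h2 hs
  rw [e3] at h1'
  rw [e4] at h2'
  have h3 : ⟪a - v, t • a - s • b⟫ + ⟪b - v, s • b - t • a⟫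
      = t * ‖a‖ ^ 2 + s * ‖b‖ ^ 2 - (s + t) * ⟪a, b⟫ := by
    rw [← real_inner_self_eq_norm_sq, ← real_inner_self_eq_norm_sq]
    simp only [inner_sub_left, inner_sub_right, inner_smul_right]
    rw [real_inner_comm a b]
    ring
  have h4 := real_inner_le_norm a b
  by_contra! hlt
  have h5 : 0 < (‖b‖ - ‖a‖) * (s * ‖b‖ - t * ‖a‖) := by
    have : t * ‖a‖ < s * ‖b‖ := by
      calc t * ‖a‖ < t * ‖b‖ := by gcongr
        _ ≤ s * ‖b‖ := by gcongr
    exact mul_pos (by linarith) (by linarith)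
  have h6 := mul_le_mul_of_nonneg_left h4 (by positivity : 0 ≤ s + t)
  nlinarith

/-- The proximal operator is jointly continuous in parameter and point, away from parameter `0`. -/
lemma continuous_prox_max (hr : ConvexOn ℝ S r) {prox : ℝ → E → E}
    (hprox : ∀ t, 0 < t → ∀ z, IsProxPoint S r t z (prox t z)) {c : ℝ} (hc : 0 < c) :
    Continuous fun a : ℝ × E => prox (max c a.1) a.2 := by
  rw [continuous_iff_continuousAt]
  rintro ⟨τ, z⟩
  have hpos : ∀ u : ℝ, 0 < max c u := fun u => lt_max_of_lt_left hc
  rw [ContinuousAt, tendsto_iff_norm_sub_tendsto_zero]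
  have hlim : Tendsto (fun a : ℝ × E => ‖a.2 - z‖
      + |1 - max c a.1 / max c τ| * ‖z - prox (max c τ) z‖) (nhds (τ, z)) (nhds 0) := by
    have hcont : Continuous (fun a : ℝ × E => ‖a.2 - z‖
      + |1 - max c a.1 / max c τ| * ‖z - prox (max c τ) z‖) := by fun_prop
    have := hcont.tendsto (τ, z)
    simpa [div_self (hpos τ).ne'] using this
  refine squeeze_zero (fun _ => norm_nonneg _) (fun a => ?_) hlim
  have h1 := (hprox _ (hpos a.1) a.2).norm_sub_le hr (hpos a.1) (hprox _ (hpos a.1) z)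
  have h2 := (hprox _ (hpos a.1) z).norm_sub_le_of_param hr (hpos a.1) (hpos τ) (hprox _ (hpos τ) z)
  have h3 := norm_sub_le_norm_sub_add_norm_sub (prox (max c a.1) a.2) (prox (max c a.1) z)
    (prox (max c τ) z)
  linarith

/-- First-order Taylor bound on a convex set for a function with Lipschitz gradient. -/
lemma abs_sub_sub_inner_le [CompleteSpace E] (hS : Convex ℝ S) {h : E → ℝ} {gh : E → E} {K : ℝ}
    (hgrad : ∀ z ∈ S, HasGradientAt h (gh z) z) (hK : 0 ≤ K)
    (hlip : ∀ z ∈ S, ∀ w ∈ S, ‖gh z - gh w‖ ≤ K * ‖z - w‖) {x y : E} (hx : x ∈ S) (hy : y ∈ S) :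
    |h y - h x - ⟪gh x, y - x⟫| ≤ K * ‖y - x‖ ^ 2 := by
  have hseg := hS.segment_subset hx hy
  have := (convex_segment (𝕜 := ℝ) x y).norm_image_sub_le_of_norm_hasFDerivWithin_le' (f := h)
    (f' := fun z => InnerProductSpace.toDual ℝ E (gh z)) (φ := InnerProductSpace.toDual ℝ E (gh x))
    (C := K * ‖y - x‖)
    (fun z hz => (hgrad z (hseg hz)).hasFDerivAt.hasFDerivWithinAt) (fun z hz => by
      rw [← map_sub, LinearIsometryEquiv.norm_map]
      refine (hlip z (hseg hz) x hx).trans ?_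
      gcongr
      obtain ⟨θ, hθ, rfl⟩ := segment_eq_image' ℝ x y ▸ hz
      rw [add_sub_cancel_left, norm_smul, Real.norm_eq_abs, abs_of_nonneg hθ.1]
      exact mul_le_of_le_one_left (norm_nonneg _) hθ.2)
    (left_mem_segment ℝ x y) (right_mem_segment ℝ x y)
  rw [InnerProductSpace.toDual_apply_apply, Real.norm_eq_abs] at this
  linarith

/-- One-step descent estimate: `x'` is the sampled proximal gradient step with step size `t`, and
`y` the exact step with reference step size `τ`. -/
lemma prox_step_descent [CompleteSpace E] (hr : ConvexOn ℝ S r) {Lr : ℝ} (hLr : 0 ≤ Lr)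
    (hrlip : ∀ z ∈ S, ∀ w ∈ S, |r z - r w| ≤ Lr * ‖z - w‖)
    {f F : E → ℝ} {g G : E → E} (hf : ∀ z ∈ S, HasGradientAt f (g z) z)
    (hF : ∀ z ∈ S, HasGradientAt F (G z) z) {L : ℝ} (hL : 0 ≤ L)
    (hglip : ∀ z ∈ S, ∀ w ∈ S, ‖g z - g w‖ ≤ L * ‖z - w‖)
    (hGlip : ∀ z ∈ S, ∀ w ∈ S, ‖G z - G w‖ ≤ L * ‖z - w‖)
    {B α c s τ δ : ℝ} (hα : 0 ≤ α) (hc : 0 < c) (hct : c ≤ t) (hts : t ≤ s)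
    (hcτ : c ≤ τ) (hτs : τ ≤ s) (hδ : δ = if t ≠ τ then 1 else 0)
    {x x' p y q : E} (hx : x ∈ S) (hB : ‖g x‖ ≤ B)
    (hx' : IsProxPoint S r t (x - t • G x) x')
    (hp : IsProxPoint S r t (x - t • g x) p)
    (hy : IsProxPoint S r τ (x - τ • g x) y) (hyp : t = τ → p = y)
    (hq : IsProxPoint S r s (x - s • g x) q)
    (harm : F x' + r x' ≤ F x + r x - (α / t) * ‖x - x'‖ ^ 2) :
    f x' + r x' + α * c / 2 * ‖(1 / s) • (x - q)‖ ^ 2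
      ≤ f x + r x + (F x - f x) - (F y - f y)
        + (α * c + (1 + 4 * L) * s ^ 2) * ‖G x - g x‖ ^ 2 + 1 / 2 * ‖G y - g y‖ ^ 2
        + (1 + 4 * L) * (2 * s * (B + Lr)) ^ 2 * δ := by
  have ht : 0 < t := hc.trans_le hct
  have hτ : 0 < τ := hc.trans_le hcτ
  have hs : 0 < s := ht.trans_le hts
  have hB0 : 0 ≤ B := (norm_nonneg _).trans hB
  have hxp : ‖x' - p‖ ≤ t * ‖G x - g x‖ := by
    refine (hx'.norm_sub_le hr ht hp).trans_eq ?_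
    rw [show x - t • G x - (x - t • g x) = -(t • (G x - g x)) by module, norm_neg, norm_smul,
      Real.norm_eq_abs, abs_of_pos ht]
  have hpy : ‖p - y‖ ≤ 2 * s * (B + Lr) * δ := by
    by_cases h : t = τ
    · simp [hyp h, hδ, h]
    · have h1 := hp.norm_step_le hr ht hLr hrlip hx
      have h2 := hy.norm_step_le hr hτ hLr hrlip hx
      have h3 : t * (‖g x‖ + Lr) ≤ s * (B + Lr) := by gcongr
      have h4 : τ * (‖g x‖ + Lr) ≤ s * (B + Lr) := by gcongr
      have h5 := norm_sub_le_norm_sub_add_norm_sub p x y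
      rw [norm_sub_rev p x] at h5
      rw [hδ, if_pos h]
      linarith
  have hδ2 : δ ^ 2 = δ := by rw [hδ]; split_ifs <;> norm_num
  have hd : ‖x' - y‖ ^ 2 ≤ 2 * s ^ 2 * ‖G x - g x‖ ^ 2 + 2 * (2 * s * (B + Lr)) ^ 2 * δ := by
    have h1 : ‖x' - y‖ ≤ s * ‖G x - g x‖ + 2 * s * (B + Lr) * δ := by
      have h5 := norm_sub_le_norm_sub_add_norm_sub x' p y
      have : t * ‖G x - g x‖ ≤ s * ‖G x - g x‖ := by gcongr
      linarith
    calc ‖x' - y‖ ^ 2 ≤ (s * ‖G x - g x‖ + 2 * s * (B + Lr) * δ) ^ 2 := by gcongr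
      _ ≤ 2 * ((s * ‖G x - g x‖) ^ 2 + (2 * s * (B + Lr) * δ) ^ 2) := add_sq_le
      _ = _ := by rw [mul_pow _ δ, hδ2]; ring
  have hbias : -(F x' - f x') ≤ -(F y - f y) + 1 / 2 * ‖G y - g y‖ ^ 2
      + (1 / 2 + 2 * L) * ‖x' - y‖ ^ 2 := by
    have h1 := abs_sub_sub_inner_le hr.1 hF hL hGlip hy.1 hx'.1
    have h2 := abs_sub_sub_inner_le hr.1 hf hL hglip hy.1 hx'.1
    have h3 := abs_real_inner_le_norm (G y - g y) (x' - y)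
    rw [inner_sub_left] at h3
    have h4 := two_mul_le_add_sq ‖G y - g y‖ ‖x' - y‖
    rw [abs_le] at h1 h2 h3
    nlinarith [h1.1, h2.2, h3.1]
  have hG : α * c / 2 * ‖(1 / s) • (x - q)‖ ^ 2
      ≤ (α / t) * ‖x - x'‖ ^ 2 + α * c * ‖G x - g x‖ ^ 2 := by
    have h1 := hp.norm_gradientMapping_anti hr ht hts hq
    have h2 : ‖(1 / t) • (x - p)‖ ≤ ‖(1 / t) • (x - x')‖ + ‖G x - g x‖ := by
      rw [show (1 / t) • (x - p) = (1 / t) • (x - x') + (1 / t) • (x' - p) by module]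
      refine (norm_add_le _ _).trans ?_
      gcongr
      rw [norm_smul, Real.norm_eq_abs, abs_of_pos (by positivity), one_div, inv_mul_le_iff₀ ht]
      exact hxp
    have h3 : ‖(1 / s) • (x - q)‖ ^ 2
        ≤ 2 * (‖(1 / t) • (x - x')‖ ^ 2 + ‖G x - g x‖ ^ 2) := by
      refine le_trans ?_ add_sq_le
      gcongr
      exact h1.trans h2
    have h4 : α * c * ‖(1 / t) • (x - x')‖ ^ 2 ≤ (α / t) * ‖x - x'‖ ^ 2 := by
      rw [norm_smul, Real.norm_eq_abs, abs_of_pos (by positivity)]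
      calc α * c * (1 / t * ‖x - x'‖) ^ 2 ≤ α * t * (1 / t * ‖x - x'‖) ^ 2 := by gcongr
        _ = (α / t) * ‖x - x'‖ ^ 2 := by field_simp
    have h5 := mul_le_mul_of_nonneg_left h3 (by positivity : 0 ≤ α * c / 2)
    linarith
  have hd' := mul_le_mul_of_nonneg_left hd (by positivity : 0 ≤ 1 / 2 + 2 * L)
  linarith

end Proximal

/-- A nonnegative sequence whose averages tend to zero has zero limit inferior. -/
lemma liminf_eq_zero_of_tendsto_average {a : ℕ → ℝ} (ha : ∀ k, 0 ≤ a k)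
    (hlim : Tendsto (fun K : ℕ => (1 / (K : ℝ)) * ∑ k ∈ Finset.range K, a k) atTop (nhds 0)) :
    atTop.liminf a = 0 := by
  have hub : ∀ b ∈ {b | ∀ᶠ k in atTop, b ≤ a k}, b ≤ 0 := by
    intro b hb
    have h1 : Tendsto (fun k => min (a k) b) atTop (nhds b) :=
      tendsto_const_nhds.congr' (hb.mono fun k hk => (min_eq_right hk).symm)
    refine le_of_tendsto_of_tendsto' h1.cesaro hlim fun K => ?_
    rw [one_div]
    gcongr
    exact min_le_left _ _
  have hmem : (0 : ℝ) ∈ {b | ∀ᶠ k in atTop, b ≤ a k} := Eventually.of_forall ha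
  rw [liminf_eq]
  exact le_antisymm (csSup_le ⟨0, hmem⟩ hub) (le_csSup ⟨0, hub⟩ hmem)

/-- Conditionally unbiased sampling of `f` at an `m`-measurable point has zero mean error. -/
lemma integral_sub_eq_zero_of_condExp {Ω : Type*} {m m0 : MeasurableSpace Ω} {μ : Measure Ω}
    [IsFiniteMeasure μ] (hm : m ≤ m0) {X Y : Ω → ℝ} (hX : Integrable X μ) (h : μ[X|m] =ᵐ[μ] Y) :
    Integrable (fun ω => X ω - Y ω) μ ∧ ∫ ω, (X ω - Y ω) ∂μ = 0 := by
  have hY : Integrable Y μ := integrable_condExp.congr h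
  refine ⟨hX.sub hY, ?_⟩
  rw [integral_sub hX hY, ← integral_condExp hm, integral_congr_ae h, sub_self]

/-- An almost sure bound on the conditional expectation bounds the expectation. -/
lemma integral_le_of_condExp_le {Ω : Type*} {m m0 : MeasurableSpace Ω} {μ : Measure Ω}
    [IsProbabilityMeasure μ] (hm : m ≤ m0) {X : Ω → ℝ} {b : ℝ} (h : ∀ᵐ ω ∂μ, (μ[X|m]) ω ≤ b) :
    ∫ ω, X ω ∂μ ≤ b := by
  rw [← integral_condExp hm]
  simpa using integral_mono_ae integrable_condExp (integrable_const b) h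

/-- Averages controlled by a summed descent inequality with vanishing average errors tend to `0`. -/
lemma tendsto_average_of_descent {a e d Φ : ℕ → ℝ} {A D B m C : ℝ} {J : ℕ → ℕ} (hA : 0 < A)
    (hB : 0 ≤ B) (ha : ∀ k, 0 ≤ a k) (hΦ : ∀ k, m ≤ Φ k)
    (hstep : ∀ k, Φ (k + 1) + A * a k ≤ Φ k + D * e k + B * d k)
    (hd : ∀ K, ∑ k ∈ Finset.range K, d k ≤ ((J K : ℝ) + 1) * C)
    (hJ : Tendsto (fun K : ℕ => (J K : ℝ) / K) atTop (nhds 0))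
    (he : Tendsto (fun K : ℕ => (1 / (K : ℝ)) * ∑ k ∈ Finset.range K, e k) atTop (nhds 0)) :
    Tendsto (fun K : ℕ => (1 / (K : ℝ)) * ∑ k ∈ Finset.range K, a k) atTop (nhds 0) := by
  have hsum : ∀ K, Φ K + A * ∑ k ∈ Finset.range K, a k
      ≤ Φ 0 + D * ∑ k ∈ Finset.range K, e k + B * ∑ k ∈ Finset.range K, d k := by
    intro K
    induction K with
    | zero => simp
    | succ K ih =>
      simp only [Finset.sum_range_succ]
      linarith [hstep K]
  have hlim : Tendsto (fun K : ℕ => A⁻¹ * ((Φ 0 - m) * (1 / (K : ℝ))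
      + D * ((1 / (K : ℝ)) * ∑ k ∈ Finset.range K, e k)
      + B * (((J K : ℝ) / K + 1 / (K : ℝ)) * C))) atTop (nhds 0) := by
    have h1 := tendsto_one_div_atTop_nhds_zero_nat (𝕜 := ℝ)
    simpa using (((h1.const_mul (Φ 0 - m)).add (he.const_mul D)).add
      (((hJ.add h1).mul_const C).const_mul B)).const_mul A⁻¹
  refine squeeze_zero (fun K => ?_) (fun K => ?_) hlim
  · have := Finset.sum_nonneg fun k (_ : k ∈ Finset.range K) => ha k
    positivity
  · rw [← mul_le_mul_iff_right₀ hA, mul_inv_cancel_left₀ hA.ne']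
    have h1 : A * ∑ k ∈ Finset.range K, a k
        ≤ (Φ 0 - m) + D * ∑ k ∈ Finset.range K, e k + B * (((J K : ℝ) + 1) * C) := by
      have := mul_le_mul_of_nonneg_left (hd K) hB
      linarith [hsum K, hΦ K]
    have h2 := mul_le_mul_of_nonneg_left h1 (by positivity : 0 ≤ 1 / (K : ℝ))
    calc _ = 1 / (K : ℝ) * (A * ∑ k ∈ Finset.range K, a k) := by ring
      _ ≤ _ := h2
      _ = _ := by ring

theorem stmt15 {n : ℕ} {Ω : Type*} {m0 : MeasurableSpace Ω} {μ : Measure Ω}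
    [IsProbabilityMeasure μ] (ℱ : Filtration ℕ m0)
    (S : Set (EuclideanSpace ℝ (Fin n))) (hSne : S.Nonempty) (hSclosed : IsClosed S)
    (r : EuclideanSpace ℝ (Fin n) → ℝ) (hrconv : ConvexOn ℝ S r)
    (Lr : ℝ) (hLr : 0 ≤ Lr)
    (hrlip : ∀ z ∈ S, ∀ w ∈ S, |r z - r w| ≤ Lr * ‖z - w‖)
    (prox : ℝ → EuclideanSpace ℝ (Fin n) → EuclideanSpace ℝ (Fin n))
    (hprox_mem : ∀ t : ℝ, 0 < t → ∀ z, prox t z ∈ S)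
    (hprox_min : ∀ t : ℝ, 0 < t → ∀ z, ∀ y ∈ S,
      r (prox t z) + ‖prox t z - z‖ ^ 2 / (2 * t) ≤ r y + ‖y - z‖ ^ 2 / (2 * t))
    (hprox_uniq : ∀ t : ℝ, 0 < t → ∀ z, ∀ y ∈ S,
      (∀ y' ∈ S, r y + ‖y - z‖ ^ 2 / (2 * t) ≤ r y' + ‖y' - z‖ ^ 2 / (2 * t)) → y = prox t z)
    (f : EuclideanSpace ℝ (Fin n) → ℝ) (g : EuclideanSpace ℝ (Fin n) → EuclideanSpace ℝ (Fin n))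
    (U : Set (EuclideanSpace ℝ (Fin n))) (hU : IsOpen U) (hSU : S ⊆ U)
    (hf : ∀ z ∈ U, HasGradientAt f (g z) z)
    (L : ℝ) (hL : 0 < L)
    (hglip : ∀ z ∈ S, ∀ w ∈ S, ‖g z - g w‖ ≤ L * ‖z - w‖)
    (Bg : ℝ) (hBg : ∀ z ∈ S, ‖g z‖ ≤ Bg)
    (φinf : ℝ) (hφinf : ∀ z ∈ S, φinf ≤ f z + r z)
    (α β s : ℝ) (hα : α ∈ Set.Ioo (0:ℝ) 1) (hβ : β ∈ Set.Ioo (0:ℝ) 1) (hs : 0 < s)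
    (c : ℝ) (hc : c = min s (2 * (1 - α) * β / L))
    (σ : ℝ) (hσ : 0 < σ)
    (N : ℕ → ℕ) (hN : ∀ k, 0 < N k)
    (x : ℕ → Ω → EuclideanSpace ℝ (Fin n)) (t : ℕ → Ω → ℝ)
    (x₀ : EuclideanSpace ℝ (Fin n)) (hx₀ : x₀ ∈ S) (hx₀det : ∀ ω, x 0 ω = x₀)
    (hxmeas : ∀ k, StronglyMeasurable[ℱ k] (x k))
    (htmeas : ∀ k, StronglyMeasurable[ℱ (k + 1)] (t k))
    (htbd : ∀ k, ∀ᵐ ω ∂μ, c ≤ t k ω ∧ t k ω ≤ s)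
    (F : ℕ → Ω → EuclideanSpace ℝ (Fin n) → ℝ) (GF : ℕ → Ω → EuclideanSpace ℝ (Fin n) → EuclideanSpace ℝ (Fin n))
    (hFgrad : ∀ k, ∀ᵐ ω ∂μ, (∀ z ∈ U, HasGradientAt (F k ω) (GF k ω z) z) ∧
      ∀ z ∈ S, ∀ w ∈ S, ‖GF k ω z - GF k ω w‖ ≤ L * ‖z - w‖)
    (horacle_f : ∀ k, ∀ y : Ω → EuclideanSpace ℝ (Fin n),
      StronglyMeasurable[ℱ k] y → (∀ ω, y ω ∈ S) →
      Integrable (fun ω => F k ω (y ω)) μ ∧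
        μ[(fun ω => F k ω (y ω))|ℱ k] =ᵐ[μ] fun ω => f (y ω))
    (horacle_g : ∀ k, ∀ y : Ω → EuclideanSpace ℝ (Fin n),
      StronglyMeasurable[ℱ k] y → (∀ ω, y ω ∈ S) →
      Integrable (fun ω => GF k ω (y ω)) μ ∧
        μ[(fun ω => GF k ω (y ω))|ℱ k] =ᵐ[μ] fun ω => g (y ω))
    (horacle_var : ∀ k, ∀ y : Ω → EuclideanSpace ℝ (Fin n),
      StronglyMeasurable[ℱ k] y → (∀ ω, y ω ∈ S) →
      Integrable (fun ω => ‖GF k ω (y ω) - g (y ω)‖ ^ 2) μ ∧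
        ∀ᵐ ω ∂μ, (μ[(fun ω' => ‖GF k ω' (y ω') - g (y ω')‖ ^ 2)|ℱ k]) ω ≤ σ ^ 2 / N k)
    (hupdate : ∀ k, ∀ᵐ ω ∂μ,
      x (k + 1) ω = prox (t k ω) (x k ω - t k ω • GF k ω (x k ω)))
    (harmijo : ∀ k, ∀ᵐ ω ∂μ, F k ω (x (k + 1) ω) + r (x (k + 1) ω)
        ≤ F k ω (x k ω) + r (x k ω) - (α / t k ω) * ‖x k ω - x (k + 1) ω‖ ^ 2)
    (C : ℝ) (hC : 0 < C)
    (J : ℕ → ℕ)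
    (hJlim : Tendsto (fun K : ℕ => (J K : ℝ) / K) atTop (nhds 0))
    (hchange : ∀ K : ℕ, ∀ᵐ ω ∂μ,
      (((Finset.range K).filter (fun i => t i ω ≠ if i = 0 then s else t (i - 1) ω)).card : ℝ) ≤ ((J K : ℝ) + 1) * C)
    (hbatch : Tendsto (fun K : ℕ => (1 / (K : ℝ)) * ∑ k ∈ Finset.range K, 1 / (N k : ℝ))
      atTop (nhds 0))
    (hφint : ∀ k, Integrable (fun ω => f (x k ω) + r (x k ω)) μ)
    (hGint : ∀ k, Integrable (fun ω => ‖(1 / s) • (x k ω - prox s (x k ω - s • g (x k ω)))‖ ^ 2) μ)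
    (hFint : ∀ k, Integrable (fun ω => F k ω (x (k + 1) ω) + r (x (k + 1) ω)) μ) :
    Tendsto (fun K : ℕ =>
        (1 / (K : ℝ)) * ∑ k ∈ Finset.range K, ∫ ω, ‖(1 / s) • (x k ω - prox s (x k ω - s • g (x k ω)))‖ ^ 2 ∂μ)
      atTop (nhds 0)
    ∧ atTop.liminf (fun k : ℕ => ∫ ω, ‖(1 / s) • (x k ω - prox s (x k ω - s • g (x k ω)))‖ ^ 2 ∂μ) = 0 := by
  have hP : ∀ t, 0 < t → ∀ z, IsProxPoint S r t z (prox t z) := fun t ht z =>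
    ⟨hprox_mem t ht z, hprox_min t ht z⟩
  have hα0 : 0 < α := hα.1
  have hc0 : 0 < c := by
    rw [hc]
    exact lt_min hs (div_pos (mul_pos (mul_pos two_pos (sub_pos.2 hα.2)) hβ.1) hL)
  have hcs : c ≤ s := hc ▸ min_le_left _ _
  have hxS : ∀ k, ∀ᵐ ω ∂μ, x k ω ∈ S := by
    intro k
    cases k with
    | zero => exact Eventually.of_forall fun ω => hx₀det ω ▸ hx₀
    | succ k =>
      filter_upwards [hupdate k, htbd k] with ω h1 h2
      exact h1 ▸ hprox_mem _ (hc0.trans_le h2.1) _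
  classical
  set Y : ℕ → Ω → EuclideanSpace ℝ (Fin n) := fun k ω => if x k ω ∈ S then x k ω else x₀ with hYdef
  set τ : ℕ → Ω → ℝ := fun k ω => if k = 0 then s else t (k - 1) ω with hτdef
  set T : ℕ → Ω → ℝ := fun k ω => max c (τ k ω) with hTdef
  set xh : ℕ → Ω → EuclideanSpace ℝ (Fin n) :=
    fun k ω => prox (T k ω) (Y k ω - T k ω • g (Y k ω)) with hxhdef
  have hYS : ∀ k ω, Y k ω ∈ S := by
    intro k ω
    simp only [hYdef]
    split_ifs with h
    exacts [h, hx₀]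
  have hYx : ∀ k, ∀ᵐ ω ∂μ, Y k ω = x k ω := fun k => (hxS k).mono fun ω h => if_pos h
  have hYm : ∀ k, Measurable[ℱ k] (Y k) := fun k =>
    Measurable.ite ((hxmeas k).measurable hSclosed.measurableSet) (hxmeas k).measurable
      measurable_const
  have hτm : ∀ k, Measurable[ℱ k] (τ k) := by
    intro k
    cases k with
    | zero => exact measurable_const
    | succ k => exact (htmeas k).measurable
  have hτbd : ∀ k, ∀ᵐ ω ∂μ, c ≤ τ k ω ∧ τ k ω ≤ s := by
    intro k
    cases k with
    | zero => exact Eventually.of_forall fun ω => ⟨hcs, le_rfl⟩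
    | succ k => exact htbd k
  have hT0 : ∀ k ω, 0 < T k ω := fun k ω => lt_max_of_lt_left hc0
  have hxhS : ∀ k ω, xh k ω ∈ S := fun k ω => hprox_mem _ (hT0 k ω) _
  have hgS : Continuous (S.domRestrict g) := continuousOn_iff_continuous_domRestrict.1 <|
    (LipschitzOnWith.of_dist_le_mul (K := L.toNNReal) fun z hz w hw => by
      rw [dist_eq_norm, dist_eq_norm, Real.coe_toNNReal _ hL.le]
      exact hglip z hz w hw).continuousOn
  have hgYm : ∀ k, Measurable[ℱ k] (fun ω => g (Y k ω)) := fun k =>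
    hgS.measurable.comp ((hYm k).subtype_mk (h := hYS k))
  have hxhm : ∀ k, Measurable[ℱ k] (xh k) := by
    intro k
    have h1 : Measurable[ℱ k] (T k) := measurable_const.max (hτm k)
    exact (continuous_prox_max hrconv hP hc0).measurable.comp
      ((hτm k).prodMk ((hYm k).sub (h1.smul (hgYm k))))
  have hYsm := fun k => (hYm k).stronglyMeasurable
  have hxhsm := fun k => (hxhm k).stronglyMeasurable
  set δ : ℕ → Ω → ℝ := fun k ω => if t k ω ≠ τ k ω then 1 else 0 with hδdef
  have hδint : ∀ k, Integrable (δ k) μ := by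
    intro k
    have hms : MeasurableSet {ω | t k ω ≠ τ k ω} :=
      (measurableSet_eq_fun ((htmeas k).measurable.mono (ℱ.le _) le_rfl)
        ((hτm k).mono (ℱ.le _) le_rfl)).compl
    refine Integrable.of_bound (C := 1)
      (Measurable.ite hms measurable_const measurable_const).aestronglyMeasurable
      (Eventually.of_forall fun ω => ?_)
    simp only [hδdef]
    split_ifs <;> simp
  have hYf := fun k => integral_sub_eq_zero_of_condExp (ℱ.le k)
    (horacle_f k (Y k) (hYsm k) (hYS k)).1 (horacle_f k (Y k) (hYsm k) (hYS k)).2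
  have hxhf := fun k => integral_sub_eq_zero_of_condExp (ℱ.le k)
    (horacle_f k (xh k) (hxhsm k) (hxhS k)).1 (horacle_f k (xh k) (hxhsm k) (hxhS k)).2
  have hYv := fun k => horacle_var k (Y k) (hYsm k) (hYS k)
  have hxhv := fun k => horacle_var k (xh k) (hxhsm k) (hxhS k)
  have hBg0 : 0 ≤ Bg := (norm_nonneg _).trans (hBg x₀ hx₀)
  have hpath : ∀ k, ∀ᵐ ω ∂μ, f (x (k + 1) ω) + r (x (k + 1) ω)
      + α * c / 2 * ‖(1 / s) • (x k ω - prox s (x k ω - s • g (x k ω)))‖ ^ 2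
      ≤ f (x k ω) + r (x k ω) + (F k ω (Y k ω) - f (Y k ω)) - (F k ω (xh k ω) - f (xh k ω))
        + (α * c + (1 + 4 * L) * s ^ 2) * ‖GF k ω (Y k ω) - g (Y k ω)‖ ^ 2
        + 1 / 2 * ‖GF k ω (xh k ω) - g (xh k ω)‖ ^ 2
        + (1 + 4 * L) * (2 * s * (Bg + Lr)) ^ 2 * δ k ω := by
    intro k
    filter_upwards [hxS k, hYx k, htbd k, hτbd k, hFgrad k, hupdate k, harmijo k]
      with ω hx hY ht hτ hFg hup harm
    have hTτ : T k ω = τ k ω := max_eq_right hτ.1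
    have ht0 := hc0.trans_le ht.1
    have hτ0 := hc0.trans_le hτ.1
    have hxh : xh k ω = prox (τ k ω) (x k ω - τ k ω • g (x k ω)) := by
      simp only [hxhdef, hTτ, hY]
    rw [hY]
    refine prox_step_descent hrconv hLr hrlip (fun z hz => hf z (hSU hz))
      (fun z hz => hFg.1 z (hSU hz)) hL.le hglip hFg.2 hα0.le hc0 ht.1 ht.2 hτ.1 hτ.2 rfl hx
      (hBg _ hx) (hup ▸ hP _ ht0 _) (hP _ ht0 _) (hxh ▸ hP _ hτ0 _) (fun h => ?_) (hP _ hs _) harm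
    rw [hxh, h]
  have hstep : ∀ k, ∫ ω, (f (x (k + 1) ω) + r (x (k + 1) ω)) ∂μ
      + α * c / 2 * ∫ ω, ‖(1 / s) • (x k ω - prox s (x k ω - s • g (x k ω)))‖ ^ 2 ∂μ
      ≤ ∫ ω, (f (x k ω) + r (x k ω)) ∂μ
        + ((α * c + (1 + 4 * L) * s ^ 2 + 1 / 2) * σ ^ 2) * (1 / (N k : ℝ))
        + (1 + 4 * L) * (2 * s * (Bg + Lr)) ^ 2 * ∫ ω, δ k ω ∂μ := by
    intro k
    have i1 := (hφint k).add (hYf k).1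
    have i2 := i1.sub (hxhf k).1
    have i3 := i2.add ((hYv k).1.const_mul (α * c + (1 + 4 * L) * s ^ 2))
    have i4 := i3.add ((hxhv k).1.const_mul (1 / 2))
    have i5 := (hδint k).const_mul ((1 + 4 * L) * (2 * s * (Bg + Lr)) ^ 2)
    have h := integral_mono_ae ((hφint (k + 1)).add ((hGint k).const_mul (α * c / 2)))
      (i4.add i5) (hpath k)
    rw [integral_add' (hφint (k + 1)) ((hGint k).const_mul (α * c / 2)), integral_add' i4 i5,
      integral_add' i3 ((hxhv k).1.const_mul (1 / 2)),
      integral_add' i2 ((hYv k).1.const_mul (α * c + (1 + 4 * L) * s ^ 2)),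
      integral_sub' i1 (hxhf k).1, integral_add' (hφint k) (hYf k).1, (hYf k).2, (hxhf k).2,
      integral_const_mul, integral_const_mul, integral_const_mul, integral_const_mul] at h
    have v1 := mul_le_mul_of_nonneg_left (integral_le_of_condExp_le (ℱ.le k) (hYv k).2)
      (by positivity : 0 ≤ α * c + (1 + 4 * L) * s ^ 2)
    have v2 := integral_le_of_condExp_le (ℱ.le k) (hxhv k).2
    have v3 : σ ^ 2 / (N k : ℝ) = σ ^ 2 * (1 / (N k : ℝ)) := by ring
    rw [v3] at v1 v2
    linarith
  have hcount : ∀ K, ∑ k ∈ Finset.range K, ∫ ω, δ k ω ∂μ ≤ ((J K : ℝ) + 1) * C := by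
    intro K
    rw [← integral_finsetSum _ fun k _ => hδint k]
    have h : ∀ᵐ ω ∂μ, ∑ k ∈ Finset.range K, δ k ω ≤ ((J K : ℝ) + 1) * C := by
      filter_upwards [hchange K] with ω hω
      simp only [hδdef, hτdef, Finset.sum_boole]
      convert hω
    simpa using integral_mono_ae (integrable_finsetSum _ fun k _ => hδint k)
      (integrable_const _) h
  have hlow : ∀ k, φinf ≤ ∫ ω, (f (x k ω) + r (x k ω)) ∂μ := by
    intro k
    simpa using integral_mono_ae (integrable_const φinf) (hφint k)
      ((hxS k).mono fun ω h => hφinf _ h)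
  have hnonneg : ∀ k, 0 ≤ ∫ ω, ‖(1 / s) • (x k ω - prox s (x k ω - s • g (x k ω)))‖ ^ 2 ∂μ :=
    fun k => integral_nonneg fun ω => by positivity
  have hmain := tendsto_average_of_descent (by positivity) (by positivity) hnonneg
    hlow hstep hcount hJlim hbatch
  exact ⟨hmain, liminf_eq_zero_of_tendsto_average hnonneg hmain⟩
end

section
/- Under the standing stochastic setup, suppose in addition that the generalized Polyak–Łojasiewicz condition ‖G_s(x)‖² ≥ μ (φ(x) − φ_inf) holds for all x ∈ dom(r), for some μ > 0. Let K ≥ 1, let c_b > 0 and c_p ∈ (0,1], suppose N_k = ⌈c_b K⌉ for all k ∈ {0, …, K−1}, suppose the sampled Armijo condition holds almost surely at every iteration k ∈ {0, …, K−1}, and suppose that almost surely the number of indices k ∈ {0, …, K−1} with t_k ≠ t_{k−1} (t_{−1} ≜ s) is at most (1/c_p + 1)⌈[log_{1/β}(sL/(2(1−α)))]_+ + 2⌉. Then (1/K) Σ_{k=0}^{K−1} E[φ(x_k) − φ_inf] ≤ 2(φ(x_0) − φ_inf)/(μ α c K) + (1/L + 6 L s² + 2 α c) σ²/(μ α c c_b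 K) + 6 L (s − c)² (L_r + 3 B_g)² ⌈[log_{1/β}(sL/(2(1−α)))]_+ + 2⌉ (c_p + 1)/(μ α c c_p K), where [u]_+ ≜ max{u, 0}. -/
open MeasureTheory Filter
open scoped RealInnerProductSpace

section Deterministic

variable {E : Type*} [NormedAddCommGroup E] [InnerProductSpace ℝ E]

/-- First-order optimality condition for a proximal point. -/
theorem inner_le_of_prox_min {S : Set E} {r : E → ℝ} (hr : ConvexOn ℝ S r) {t : ℝ} (ht : 0 < t)
    {z p w : E} (hp : p ∈ S) (hw : w ∈ S)
    (hmin : ∀ y ∈ S, r p + ‖p - z‖ ^ 2 / (2 * t) ≤ r y + ‖y - z‖ ^ 2 / (2 * t)) :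
    ⟪z - p, w - p⟫ ≤ t * (r w - r p) := by
  have key : ∀ θ : ℝ, 0 < θ → θ ≤ 1 →
      ⟪z - p, w - p⟫ - t * (r w - r p) ≤ θ * (‖w - p‖ ^ 2 / 2) := by
    intro θ h0 h1
    have hmem : (1 - θ) • p + θ • w ∈ S := hr.1 hp hw (by linarith) h0.le (by ring)
    have hconv := hr.2 hp hw (by linarith : 0 ≤ 1 - θ) h0.le (by ring)
    have hm := hmin _ hmem
    have heq : (1 - θ) • p + θ • w - z = θ • (w - p) - (z - p) := by module
    have hnorm : ‖θ • (w - p) - (z - p)‖ ^ 2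
        = θ ^ 2 * ‖w - p‖ ^ 2 - 2 * (θ * ⟪z - p, w - p⟫) + ‖p - z‖ ^ 2 := by
      rw [norm_sub_sq_real, real_inner_smul_left, norm_smul, Real.norm_eq_abs, mul_pow, sq_abs,
        real_inner_comm, norm_sub_rev z p]
    rw [heq, hnorm] at hm
    simp only [smul_eq_mul] at hconv
    have h2 : ‖p - z‖ ^ 2 / (2 * t) * (2 * t) = ‖p - z‖ ^ 2 := by field_simp
    have h3 : (θ ^ 2 * ‖w - p‖ ^ 2 - 2 * (θ * ⟪z - p, w - p⟫) + ‖p - z‖ ^ 2) / (2 * t) * (2 * t)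
        = θ ^ 2 * ‖w - p‖ ^ 2 - 2 * (θ * ⟪z - p, w - p⟫) + ‖p - z‖ ^ 2 := by field_simp
    have h4 := mul_le_mul_of_nonneg_right (hm.trans (add_le_add_left hconv _))
      (by positivity : 0 ≤ 2 * t)
    rw [add_mul, add_mul, h2, h3] at h4
    refine le_of_mul_le_mul_left ?_ h0
    nlinarith
  by_contra! hcon
  set A := ⟪z - p, w - p⟫ - t * (r w - r p) with hA
  have hApos : 0 < A := by linarith
  set B := ‖w - p‖ ^ 2 / 2
  have hB : 0 ≤ B := by positivity
  have := key (A / (A + B)) (by positivity) ((div_le_one (by positivity)).2 (by linarith))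
  rw [div_mul_eq_mul_div, le_div_iff₀ (by positivity)] at this
  nlinarith

/-- One-sided quadratic upper bound for a function whose gradient is Lipschitz on a convex set. -/
theorem le_add_inner_add_of_lipschitz_gradient [CompleteSpace E] {S : Set E} (hS : Convex ℝ S)
    {h : E → ℝ} {G : E → E} (hG : ∀ z ∈ S, HasGradientAt h (G z) z) {M : ℝ}
    (hlip : ∀ z ∈ S, ∀ w ∈ S, ‖G z - G w‖ ≤ M * ‖z - w‖) {a b : E} (ha : a ∈ S) (hb : b ∈ S) :
    h b ≤ h a + ⟪G a, b - a⟫ + M / 2 * ‖b - a‖ ^ 2 := by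
  have hmem : ∀ θ ∈ Set.Icc (0 : ℝ) 1, a + θ • (b - a) ∈ S := fun θ hθ => by
    have := hS ha hb (sub_nonneg.2 hθ.2) hθ.1 (by ring)
    convert this using 1
    module
  have hder : ∀ θ ∈ Set.Icc (0 : ℝ) 1,
      HasDerivAt (fun θ : ℝ => h (a + θ • (b - a)) - θ * ⟪G a, b - a⟫
        - θ ^ 2 * (M / 2 * ‖b - a‖ ^ 2))
        (⟪G (a + θ • (b - a)), b - a⟫ - ⟪G a, b - a⟫ - 2 * θ * (M / 2 * ‖b - a‖ ^ 2)) θ := by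
    intro θ hθ
    have h1 : HasDerivAt (fun θ : ℝ => a + θ • (b - a)) (b - a) θ := by
      simpa using ((hasDerivAt_id θ).smul_const (b - a)).const_add a
    have h2 := (hG _ (hmem θ hθ)).hasFDerivAt.comp_hasDerivAt θ h1
    have h3 := (h2.sub ((hasDerivAt_id θ).mul_const ⟪G a, b - a⟫)).sub
      (((hasDerivAt_id θ).pow 2).mul_const (M / 2 * ‖b - a‖ ^ 2))
    refine h3.congr_deriv ?_
    simp
  have hanti := antitoneOn_of_deriv_nonpos (convex_Icc (0 : ℝ) 1)
    (fun θ hθ => (hder θ hθ).continuousAt.continuousWithinAt)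
    (fun θ hθ => (hder θ (interior_subset hθ)).differentiableAt.differentiableWithinAt)
    (fun θ hθ => by
      have hθ' := interior_subset hθ
      rw [(hder θ hθ').deriv, ← inner_sub_left]
      have h1 := real_inner_le_norm (G (a + θ • (b - a)) - G a) (b - a)
      have h2 := hlip _ (hmem θ hθ') _ ha
      rw [add_sub_cancel_left, norm_smul, Real.norm_eq_abs, abs_of_nonneg hθ'.1] at h2
      nlinarith [norm_nonneg (b - a)])
  have := hanti (Set.left_mem_Icc.2 zero_le_one) (Set.right_mem_Icc.2 zero_le_one) zero_le_one
  simp only [one_smul, add_sub_cancel, zero_smul, add_zero] at this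
  linarith

/-- `P` satisfies the first-order optimality condition of the proximal operator of `r`,
restricted to `S`. -/
structure IsProxOn (S : Set E) (r : E → ℝ) (P : ℝ → E → E) : Prop where
  mem : ∀ t, 0 < t → ∀ z, P t z ∈ S
  inner_le : ∀ t, 0 < t → ∀ z, ∀ w ∈ S, ⟪z - P t z, w - P t z⟫ ≤ t * (r w - r (P t z))

namespace IsProxOn

variable {S : Set E} {r : E → ℝ} {P : ℝ → E → E} (hP : IsProxOn S r P)

include hP

theorem norm_sub_le {t : ℝ} (ht : 0 < t) (z w : E) : ‖P t z - P t w‖ ≤ ‖z - w‖ := by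
  have h1 := hP.inner_le t ht z _ (hP.mem t ht w)
  have h2 := hP.inner_le t ht w _ (hP.mem t ht z)
  set p := P t z
  set q := P t w
  have h3 : ⟪z - p, q - p⟫ + ⟪w - q, p - q⟫ = ‖p - q‖ ^ 2 - ⟪z - w, p - q⟫ := by
    rw [← real_inner_self_eq_norm_sq]
    simp only [inner_sub_left, inner_sub_right]
    ring
  have h4 := real_inner_le_norm (z - w) (p - q)
  by_contra! h
  nlinarith [norm_nonneg (z - w)]

/-- Monotonicity of the subdifferential along two proximal gradient steps from `x`. -/
theorem inner_step_nonneg {t t' : ℝ} (ht : 0 < t) (ht' : 0 < t') (x v : E) :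
    0 ≤ ⟪(1 / t) • (x - P t (x - t • v)) - (1 / t') • (x - P t' (x - t' • v)),
      P t (x - t • v) - P t' (x - t' • v)⟫ := by
  have h1 := hP.inner_le t ht (x - t • v) _ (hP.mem t' ht' (x - t' • v))
  have h2 := hP.inner_le t' ht' (x - t' • v) _ (hP.mem t ht (x - t • v))
  set p := P t (x - t • v)
  set q := P t' (x - t' • v)
  have e1 : x - t • v - p = t • ((1 / t) • (x - p) - v) := by
    rw [smul_sub, smul_smul, mul_one_div_cancel ht.ne', one_smul]; abel
  have e2 : x - t' • v - q = t' • ((1 / t') • (x - q) - v) := by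
    rw [smul_sub, smul_smul, mul_one_div_cancel ht'.ne', one_smul]; abel
  rw [e1, real_inner_smul_left] at h1
  rw [e2, real_inner_smul_left] at h2
  have h1' := le_of_mul_le_mul_left h1 ht
  have h2' := le_of_mul_le_mul_left h2 ht'
  generalize (1 / t) • (x - p) = u at *
  generalize (1 / t') • (x - q) = u' at *
  simp only [inner_sub_left, inner_sub_right] at *
  linarith

theorem norm_step_le {Lr : ℝ} (hlip : ∀ z ∈ S, ∀ w ∈ S, |r z - r w| ≤ Lr * ‖z - w‖)
    {t : ℝ} (ht : 0 < t) {x : E} (hx : x ∈ S) (v : E) (hLv : 0 ≤ Lr + ‖v‖) :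
    ‖(1 / t) • (x - P t (x - t • v))‖ ≤ Lr + ‖v‖ := by
  have h1 := hP.inner_le t ht (x - t • v) _ hx
  have hl := (le_abs_self _).trans (hlip x hx _ (hP.mem t ht (x - t • v)))
  set p := P t (x - t • v)
  have h2 : ⟪x - t • v - p, x - p⟫ = ‖x - p‖ ^ 2 - t * ⟪v, x - p⟫ := by
    rw [← real_inner_self_eq_norm_sq]
    simp only [inner_sub_left, inner_sub_right, real_inner_smul_left]
    ring
  have h3 := real_inner_le_norm v (x - p)
  rw [norm_smul, Real.norm_of_nonneg (by positivity), one_div, inv_mul_le_iff₀ ht]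
  by_contra! h
  have h4 : t * ⟪v, x - p⟫ ≤ t * (‖v‖ * ‖x - p‖) := mul_le_mul_of_nonneg_left h3 ht.le
  have h5 := mul_le_mul_of_nonneg_left hl ht.le
  have h6 : 0 < ‖x - p‖ := lt_of_le_of_lt (by positivity) h
  nlinarith

theorem norm_sub_step_le {t t' : ℝ} (ht : 0 < t) (ht' : 0 < t') (x v : E) :
    ‖P t (x - t • v) - P t' (x - t' • v)‖
      ≤ |t - t'| * ‖(1 / t') • (x - P t' (x - t' • v))‖ := by
  have h := hP.inner_step_nonneg ht ht' x v
  set p := P t (x - t • v)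
  set q := P t' (x - t' • v)
  have e : x - q = t' • ((1 / t') • (x - q)) := by
    rw [smul_smul, mul_one_div_cancel ht'.ne', one_smul]
  set u := (1 / t') • (x - q)
  have e' : (1 / t) • (x - p) - u = (1 / t) • (-(p - q) - (t - t') • u) := by
    have : x - p = -(p - q) + t' • u := by rw [← e]; abel
    rw [this]
    have h1 : u = (1 / t) • (t • u) := by rw [smul_smul, one_div_mul_cancel ht.ne', one_smul]
    nth_rw 2 [h1]
    module
  rw [e', real_inner_smul_left] at h
  have h' := nonneg_of_mul_nonneg_right h (by positivity : (0:ℝ) < 1 / t)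
  rw [inner_sub_left, inner_neg_left, real_inner_self_eq_norm_sq] at h'
  have h2 := (neg_le_abs _).trans (abs_real_inner_le_norm ((t - t') • u) (p - q))
  rw [norm_smul, Real.norm_eq_abs] at h2
  by_contra! hcon
  have : 0 ≤ |t - t'| * ‖u‖ := by positivity
  nlinarith

theorem norm_step_antitone {t t' : ℝ} (ht : 0 < t) (htt' : t ≤ t') (x v : E) :
    ‖(1 / t') • (x - P t' (x - t' • v))‖ ≤ ‖(1 / t) • (x - P t (x - t • v))‖ := by
  have ht' := ht.trans_le htt'
  have h := hP.inner_step_nonneg ht ht' x v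
  set p := P t (x - t • v)
  set q := P t' (x - t' • v)
  have e : x - q = t' • ((1 / t') • (x - q)) := by
    rw [smul_smul, mul_one_div_cancel ht'.ne', one_smul]
  have e' : x - p = t • ((1 / t) • (x - p)) := by
    rw [smul_smul, mul_one_div_cancel ht.ne', one_smul]
  set b := (1 / t') • (x - q)
  set a := (1 / t) • (x - p)
  have e'' : p - q = t' • b - t • a := by rw [← e, ← e']; abel
  rw [e''] at h
  have h2 := real_inner_le_norm a b
  simp only [inner_sub_left, inner_sub_right, real_inner_smul_right, real_inner_self_eq_norm_sq,
    real_inner_comm a b] at h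
  by_contra! hcon
  have h3 : (t' + t) * ⟪a, b⟫ ≤ (t' + t) * (‖a‖ * ‖b‖) :=
    mul_le_mul_of_nonneg_left h2 (by positivity)
  have h4 : 0 < t' * ‖b‖ - t * ‖a‖ := by nlinarith [norm_nonneg a, norm_nonneg b]
  nlinarith

theorem norm_sub_prox_grad_le {Lr : ℝ} (hlip : ∀ z ∈ S, ∀ w ∈ S, |r z - r w| ≤ Lr * ‖z - w‖)
    {t t' : ℝ} (ht : 0 < t) (ht' : 0 < t') {x : E} (hx : x ∈ S) (y w v : E)
    (hLv : 0 ≤ Lr + ‖v‖) :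
    ‖P t (y - t • w) - P t' (x - t' • v)‖
      ≤ ‖(y - t • w) - (x - t • v)‖ + |t - t'| * (Lr + ‖v‖) :=
  (norm_sub_le_norm_sub_add_norm_sub _ (P t (x - t • v)) _).trans
    (add_le_add (hP.norm_sub_le ht _ _) ((hP.norm_sub_step_le ht ht' x v).trans
      (mul_le_mul_of_nonneg_left (hP.norm_step_le hlip ht' hx v hLv) (abs_nonneg _))))

end IsProxOn

end Deterministic

section Step

variable {E : Type*} [NormedAddCommGroup E] [InnerProductSpace ℝ E]

/-- Sufficient decrease in the sampled objective dominates the squared proximal gradient. -/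
theorem IsProxOn.norm_sq_step_le {S : Set E} {r : E → ℝ} {P : ℝ → E → E} (hP : IsProxOn S r P)
    {c s t : ℝ} (hc : 0 < c) (hct : c ≤ t) (hts : t ≤ s) (x v w : E) :
    c / 2 * ‖(1 / s) • (x - P s (x - s • v))‖ ^ 2
      ≤ ‖x - P t (x - t • w)‖ ^ 2 / t + c * ‖w - v‖ ^ 2 := by
  have ht := hc.trans_le hct
  have hs := ht.trans_le hts
  have h1 := hP.norm_step_antitone ht hts x w
  have h2 : ‖(1 / s) • (x - P s (x - s • v))‖ ≤ ‖(1 / s) • (x - P s (x - s • w))‖ + ‖w - v‖ := by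
    have h3 := hP.norm_sub_le hs (x - s • w) (x - s • v)
    have e1 : x - s • w - (x - s • v) = -(s • (w - v)) := by module
    rw [e1, norm_neg, norm_smul, Real.norm_of_nonneg hs.le] at h3
    have e2 : (1 / s) • (x - P s (x - s • v)) = (1 / s) • (x - P s (x - s • w))
        + (1 / s) • (P s (x - s • w) - P s (x - s • v)) := by module
    rw [e2]
    refine (norm_add_le _ _).trans (add_le_add le_rfl ?_)
    rw [norm_smul, Real.norm_of_nonneg (by positivity), one_div, inv_mul_le_iff₀ hs]
    exact h3
  have e3 : ‖x - P t (x - t • w)‖ ^ 2 / t = t * ‖(1 / t) • (x - P t (x - t • w))‖ ^ 2 := by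
    rw [norm_smul, Real.norm_of_nonneg (by positivity)]
    field_simp
  rw [e3]
  set a := ‖(1 / t) • (x - P t (x - t • w))‖
  set b := ‖(1 / s) • (x - P s (x - s • w))‖
  set d := ‖(1 / s) • (x - P s (x - s • v))‖
  have hb : 0 ≤ b := norm_nonneg _
  have hd : 0 ≤ d := norm_nonneg _
  have h4 : d ^ 2 ≤ 2 * a ^ 2 + 2 * ‖w - v‖ ^ 2 := by
    have : d ≤ a + ‖w - v‖ := h2.trans (add_le_add h1 le_rfl)
    nlinarith [sq_nonneg (a - ‖w - v‖)]
  have h5 : c * a ^ 2 ≤ t * a ^ 2 := mul_le_mul_of_nonneg_right hct (sq_nonneg _)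
  nlinarith

/-- One iteration of the stochastic proximal gradient method, compared with the proximal gradient
step for the exact gradient `g x` and a step size `τ`. -/
theorem IsProxOn.sampled_armijo_descent [CompleteSpace E] {S : Set E} {r : E → ℝ}
    {P : ℝ → E → E} (hP : IsProxOn S r P) (hS : Convex ℝ S) {Lr : ℝ} (hLr : 0 ≤ Lr)
    (hrlip : ∀ z ∈ S, ∀ w ∈ S, |r z - r w| ≤ Lr * ‖z - w‖)
    {f F : E → ℝ} {g G : E → E} {L : ℝ} (hL : 0 < L)
    (hf : ∀ z ∈ S, HasGradientAt f (g z) z) (hF : ∀ z ∈ S, HasGradientAt F (G z) z)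
    (hg : ∀ z ∈ S, ∀ w ∈ S, ‖g z - g w‖ ≤ L * ‖z - w‖)
    (hG : ∀ z ∈ S, ∀ w ∈ S, ‖G z - G w‖ ≤ L * ‖z - w‖)
    {Bg : ℝ} (hBg : ∀ z ∈ S, ‖g z‖ ≤ Bg) {α c s t τ : ℝ} (hα : 0 < α) (hc : 0 < c)
    (hct : c ≤ t) (hts : t ≤ s) (hcτ : c ≤ τ) (hτs : τ ≤ s) {x x' y : E} (hx : x ∈ S)
    (hx' : x' = P t (x - t • G x)) (hy : y = P τ (x - τ • g x))
    (harmijo : F x' + r x' ≤ F x + r x - (α / t) * ‖x - x'‖ ^ 2) :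
    f x' + r x' ≤ f x + r x + (F x - f x) + (f y - F y)
      - α * c / 2 * ‖(1 / s) • (x - P s (x - s • g x))‖ ^ 2
      + (α * c + 3 * L * s ^ 2) * ‖G x - g x‖ ^ 2 + 1 / (2 * L) * ‖G y - g y‖ ^ 2
      + 3 * L * (s - c) ^ 2 * (Lr + 3 * Bg) ^ 2 * (if t ≠ τ then 1 else 0) := by
  have ht := hc.trans_le hct
  have hτ := hc.trans_le hcτ
  have hx'S : x' ∈ S := hx' ▸ hP.mem t ht _
  have hyS : y ∈ S := hy ▸ hP.mem τ hτ _
  have hB0 : 0 ≤ Bg := (norm_nonneg _).trans (hBg x hx)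
  have hdesc := le_add_inner_add_of_lipschitz_gradient hS (h := fun z => f z - F z)
    (G := fun z => g z - G z) (M := 2 * L)
    (fun z hz => by
      have := (hf z hz).hasFDerivAt.sub (hF z hz).hasFDerivAt
      rw [hasGradientAt_iff_hasFDerivAt, map_sub]
      exact this)
    (fun z hz w hw => by
      have e : g z - G z - (g w - G w) = (g z - g w) - (G z - G w) := by abel
      rw [e]
      linarith [_root_.norm_sub_le (g z - g w) (G z - G w), hg z hz w hw, hG z hz w hw]) hyS hx'S
  have hinner : ⟪g y - G y, x' - y⟫ ≤ 1 / (2 * L) * ‖G y - g y‖ ^ 2 + L / 2 * ‖x' - y‖ ^ 2 := by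
    refine (real_inner_le_norm _ _).trans ?_
    rw [norm_sub_rev (g y)]
    have : 1 / (2 * L) * ‖G y - g y‖ ^ 2 + L / 2 * ‖x' - y‖ ^ 2 - ‖G y - g y‖ * ‖x' - y‖
        = 1 / (2 * L) * (‖G y - g y‖ - L * ‖x' - y‖) ^ 2 := by field_simp; ring
    have h2 : 0 ≤ 1 / (2 * L) * (‖G y - g y‖ - L * ‖x' - y‖) ^ 2 := by positivity
    linarith
  have hdist : ‖x' - y‖ ≤ s * ‖G x - g x‖ + |t - τ| * (Lr + 3 * Bg) := by
    rw [hx', hy]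
    refine (hP.norm_sub_prox_grad_le hrlip ht hτ hx x (G x) (g x) (by positivity)).trans ?_
    have e : x - t • G x - (x - t • g x) = -(t • (G x - g x)) := by module
    rw [e, norm_neg, norm_smul, Real.norm_of_nonneg ht.le]
    gcongr
    linarith [hBg x hx]
  have hchange : |t - τ| ^ 2 ≤ (s - c) ^ 2 * (if t ≠ τ then 1 else 0) := by
    split_ifs with h
    · rw [mul_one]
      exact pow_le_pow_left₀ (abs_nonneg _) (abs_le.2 ⟨by linarith, by linarith⟩) 2
    · simp [not_not.1 h]
  have hsq : ‖x' - y‖ ^ 2 ≤ 2 * (s ^ 2 * ‖G x - g x‖ ^ 2)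
      + 2 * ((s - c) ^ 2 * (if t ≠ τ then 1 else 0) * (Lr + 3 * Bg) ^ 2) := by
    calc ‖x' - y‖ ^ 2 ≤ (s * ‖G x - g x‖ + |t - τ| * (Lr + 3 * Bg)) ^ 2 :=
          pow_le_pow_left₀ (norm_nonneg _) hdist 2
      _ ≤ 2 * (s ^ 2 * ‖G x - g x‖ ^ 2) + 2 * (|t - τ| ^ 2 * (Lr + 3 * Bg) ^ 2) := by
          nlinarith [sq_nonneg (s * ‖G x - g x‖ - |t - τ| * (Lr + 3 * Bg))]
      _ ≤ _ := by gcongr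
  have hstep := mul_le_mul_of_nonneg_left
    (hP.norm_sq_step_le hc hct hts x (g x) (G x)) hα.le
  rw [← hx'] at hstep
  have e : α / t * ‖x - x'‖ ^ 2 = α * (‖x - x'‖ ^ 2 / t) := by ring
  rw [e] at harmijo
  have hsq' := mul_le_mul_of_nonneg_left hsq (by positivity : 0 ≤ 3 * L / 2)
  linarith

end Step

section Stochastic

theorem exists_stronglyMeasurable_mem {Ω E : Type*} {m : MeasurableSpace Ω} [TopologicalSpace E]
    [TopologicalSpace.PseudoMetrizableSpace E] {S : Set E} (hS : IsClosed S) {x₀ : E}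
    (hx₀ : x₀ ∈ S) {x : Ω → E} (hx : StronglyMeasurable x) :
    ∃ x' : Ω → E, StronglyMeasurable x' ∧ (∀ ω, x' ω ∈ S) ∧ ∀ ω, x ω ∈ S → x' ω = x ω := by
  classical
  borelize E
  refine ⟨fun ω => if x ω ∈ S then x ω else x₀,
    StronglyMeasurable.ite (hx.measurable hS.measurableSet) hx stronglyMeasurable_const,
    fun ω => ?_, fun ω hω => if_pos hω⟩
  by_cases h : x ω ∈ S <;> simp [h, hx₀]

theorem IsProxOn.continuousOn_prox_grad {E : Type*} [NormedAddCommGroup E] [InnerProductSpace ℝ E]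
    {S : Set E} {r : E → ℝ} {P : ℝ → E → E} (hP : IsProxOn S r P) {Lr : ℝ} (hLr : 0 ≤ Lr)
    (hrlip : ∀ z ∈ S, ∀ w ∈ S, |r z - r w| ≤ Lr * ‖z - w‖) {g : E → E} (hg : ContinuousOn g S)
    {c s : ℝ} (hc : 0 < c) :
    ContinuousOn (fun p : ℝ × E => P p.1 (p.2 - p.1 • g p.2)) (Set.Icc c s ×ˢ S) := by
  have hg' : ContinuousOn (fun p : ℝ × E => g p.2) (Set.Icc c s ×ˢ S) :=
    hg.comp continuousOn_snd fun p hp => hp.2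
  intro p hp
  have hp1 := hc.trans_le hp.1.1
  have hbound : ContinuousOn (fun q : ℝ × E => ‖(q.2 - q.1 • g q.2) - (p.2 - q.1 • g p.2)‖
      + |q.1 - p.1| * (Lr + ‖g p.2‖)) (Set.Icc c s ×ˢ S) := by fun_prop
  have h0 := hbound p hp
  rw [ContinuousWithinAt] at h0 ⊢
  rw [tendsto_iff_norm_sub_tendsto_zero]
  refine squeeze_zero' (Eventually.of_forall fun _ => norm_nonneg _) ?_ (by simpa using h0)
  filter_upwards [self_mem_nhdsWithin] with q hq
  exact hP.norm_sub_prox_grad_le hrlip (hc.trans_le hq.1.1) hp1 hp.2 _ _ _ (by positivity)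

theorem ContinuousOn.stronglyMeasurable_comp {Ω X Y : Type*} {m : MeasurableSpace Ω}
    [TopologicalSpace X] [MeasurableSpace X] [BorelSpace X] [SecondCountableTopology X]
    [TopologicalSpace.PseudoMetrizableSpace X]
    [TopologicalSpace Y] {A : Set X} {h : X → Y} (hh : ContinuousOn h A) {u : Ω → X}
    (hu : Measurable u) (huA : ∀ ω, u ω ∈ A) : StronglyMeasurable fun ω => h (u ω) :=
  (continuousOn_iff_continuous_domRestrict.1 hh).comp_stronglyMeasurable
    (hu.subtype_mk (h := huA)).stronglyMeasurable

theorem integral_le_of_ae_condExp_le {Ω : Type*} {m m0 : MeasurableSpace Ω} {μ : Measure Ω}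
    [IsProbabilityMeasure μ] (hm : m ≤ m0) {X : Ω → ℝ} {C : ℝ} (h : ∀ᵐ ω ∂μ, (μ[X|m]) ω ≤ C) :
    ∫ ω, X ω ∂μ ≤ C := by
  rw [← integral_condExp hm]
  simpa using integral_mono_ae integrable_condExp (integrable_const C) h

theorem integrable_and_integral_eq_of_condExp_ae_eq {Ω : Type*} {m m0 : MeasurableSpace Ω}
    {μ : Measure Ω} [IsFiniteMeasure μ] (hm : m ≤ m0) {X Y : Ω → ℝ} (h : μ[X|m] =ᵐ[μ] Y) :
    Integrable Y μ ∧ ∫ ω, X ω ∂μ = ∫ ω, Y ω ∂μ :=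
  ⟨integrable_condExp.congr h, by rw [← integral_condExp hm]; exact integral_congr_ae h⟩

theorem integrable_ite_ne {Ω : Type*} {m0 : MeasurableSpace Ω} {μ : Measure Ω}
    [IsFiniteMeasure μ] {a b : Ω → ℝ} (ha : Measurable a) (hb : Measurable b) :
    Integrable (fun ω => if a ω ≠ b ω then (1 : ℝ) else 0) μ := by
  refine Integrable.of_bound (C := 1) (Measurable.ite (measurableSet_eq_fun ha hb).compl
    measurable_const measurable_const).aestronglyMeasurable (ae_of_all _ fun ω => ?_)
  split_ifs <;> simp

end Stochastic

theorem stmt16 {n : ℕ} {Ω : Type*} {m0 : MeasurableSpace Ω} {μ : Measure Ω}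
    [IsProbabilityMeasure μ] (ℱ : Filtration ℕ m0)
    (S : Set (EuclideanSpace ℝ (Fin n))) (hSne : S.Nonempty) (hSclosed : IsClosed S)
    (r : EuclideanSpace ℝ (Fin n) → ℝ) (hrconv : ConvexOn ℝ S r)
    (Lr : ℝ) (hLr : 0 ≤ Lr)
    (hrlip : ∀ z ∈ S, ∀ w ∈ S, |r z - r w| ≤ Lr * ‖z - w‖)
    (prox : ℝ → EuclideanSpace ℝ (Fin n) → EuclideanSpace ℝ (Fin n))
    (hprox_mem : ∀ t : ℝ, 0 < t → ∀ z, prox t z ∈ S)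
    (hprox_min : ∀ t : ℝ, 0 < t → ∀ z, ∀ y ∈ S,
      r (prox t z) + ‖prox t z - z‖ ^ 2 / (2 * t) ≤ r y + ‖y - z‖ ^ 2 / (2 * t))
    (hprox_uniq : ∀ t : ℝ, 0 < t → ∀ z, ∀ y ∈ S,
      (∀ y' ∈ S, r y + ‖y - z‖ ^ 2 / (2 * t) ≤ r y' + ‖y' - z‖ ^ 2 / (2 * t)) → y = prox t z)
    (f : EuclideanSpace ℝ (Fin n) → ℝ) (g : EuclideanSpace ℝ (Fin n) → EuclideanSpace ℝ (Fin n))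
    (U : Set (EuclideanSpace ℝ (Fin n))) (hU : IsOpen U) (hSU : S ⊆ U)
    (hf : ∀ z ∈ U, HasGradientAt f (g z) z)
    (L : ℝ) (hL : 0 < L)
    (hglip : ∀ z ∈ S, ∀ w ∈ S, ‖g z - g w‖ ≤ L * ‖z - w‖)
    (Bg : ℝ) (hBg : ∀ z ∈ S, ‖g z‖ ≤ Bg)
    (φinf : ℝ) (hφinf : ∀ z ∈ S, φinf ≤ f z + r z)
    (α β s : ℝ) (hα : α ∈ Set.Ioo (0:ℝ) 1) (hβ : β ∈ Set.Ioo (0:ℝ) 1) (hs : 0 < s)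
    (c : ℝ) (hc : c = min s (2 * (1 - α) * β / L))
    (σ : ℝ) (hσ : 0 < σ)
    (N : ℕ → ℕ) (hN : ∀ k, 0 < N k)
    (x : ℕ → Ω → EuclideanSpace ℝ (Fin n)) (t : ℕ → Ω → ℝ)
    (x₀ : EuclideanSpace ℝ (Fin n)) (hx₀ : x₀ ∈ S) (hx₀det : ∀ ω, x 0 ω = x₀)
    (hxmeas : ∀ k, StronglyMeasurable[ℱ k] (x k))
    (htmeas : ∀ k, StronglyMeasurable[ℱ (k + 1)] (t k))
    (htbd : ∀ k, ∀ᵐ ω ∂μ, c ≤ t k ω ∧ t k ω ≤ s)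
    (F : ℕ → Ω → EuclideanSpace ℝ (Fin n) → ℝ) (GF : ℕ → Ω → EuclideanSpace ℝ (Fin n) → EuclideanSpace ℝ (Fin n))
    (hFgrad : ∀ k, ∀ᵐ ω ∂μ, (∀ z ∈ U, HasGradientAt (F k ω) (GF k ω z) z) ∧
      ∀ z ∈ S, ∀ w ∈ S, ‖GF k ω z - GF k ω w‖ ≤ L * ‖z - w‖)
    (horacle_f : ∀ k, ∀ y : Ω → EuclideanSpace ℝ (Fin n),
      StronglyMeasurable[ℱ k] y → (∀ ω, y ω ∈ S) →
      Integrable (fun ω => F k ω (y ω)) μ ∧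
        μ[(fun ω => F k ω (y ω))|ℱ k] =ᵐ[μ] fun ω => f (y ω))
    (horacle_g : ∀ k, ∀ y : Ω → EuclideanSpace ℝ (Fin n),
      StronglyMeasurable[ℱ k] y → (∀ ω, y ω ∈ S) →
      Integrable (fun ω => GF k ω (y ω)) μ ∧
        μ[(fun ω => GF k ω (y ω))|ℱ k] =ᵐ[μ] fun ω => g (y ω))
    (horacle_var : ∀ k, ∀ y : Ω → EuclideanSpace ℝ (Fin n),
      StronglyMeasurable[ℱ k] y → (∀ ω, y ω ∈ S) →
      Integrable (fun ω => ‖GF k ω (y ω) - g (y ω)‖ ^ 2) μ ∧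
        ∀ᵐ ω ∂μ, (μ[(fun ω' => ‖GF k ω' (y ω') - g (y ω')‖ ^ 2)|ℱ k]) ω ≤ σ ^ 2 / N k)
    (hupdate : ∀ k, ∀ᵐ ω ∂μ,
      x (k + 1) ω = prox (t k ω) (x k ω - t k ω • GF k ω (x k ω)))
    (μPL : ℝ) (hμPL : 0 < μPL)
    (hPL : ∀ z ∈ S, μPL * (f z + r z - φinf) ≤ ‖(1 / s) • (z - prox s (z - s • g (z)))‖ ^ 2)
    (K : ℕ) (hK : 1 ≤ K)
    (cb cp : ℝ) (hcb : 0 < cb) (hcp : cp ∈ Set.Ioc (0:ℝ) 1)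
    (hNdef : ∀ k, k < K → N k = ⌈cb * K⌉₊)
    (harmijo : ∀ k, k < K → ∀ᵐ ω ∂μ, F k ω (x (k + 1) ω) + r (x (k + 1) ω)
        ≤ F k ω (x k ω) + r (x k ω) - (α / t k ω) * ‖x k ω - x (k + 1) ω‖ ^ 2)
    (hφint : ∀ k, k ≤ K → Integrable (fun ω => f (x k ω) + r (x k ω)) μ)
    (hGint : ∀ k, k < K → Integrable (fun ω => ‖(1 / s) • (x k ω - prox s (x k ω - s • g (x k ω)))‖ ^ 2) μ)
    (hFint : ∀ k, k < K → Integrable (fun ω => F k ω (x (k + 1) ω) + r (x (k + 1) ω)) μ)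
    (hchange : ∀ᵐ ω ∂μ,
      (((Finset.range K).filter (fun i => t i ω ≠ if i = 0 then s else t (i - 1) ω)).card : ℝ) ≤ (1 / cp + 1) * ((⌈max (Real.logb (1 / β) (s * L / (2 * (1 - α)))) 0 + 2⌉ : ℤ) : ℝ)) :
    (1 / K) * ∑ k ∈ Finset.range K, ∫ ω, (f (x k ω) + r (x k ω) - φinf) ∂μ
      ≤ 2 * (f x₀ + r x₀ - φinf) / (μPL * α * c * K)
        + (1 / L + 6 * L * s ^ 2 + 2 * α * c) * σ ^ 2 / (μPL * α * c * cb * K)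
        + 6 * L * (s - c) ^ 2 * (Lr + 3 * Bg) ^ 2 * ((⌈max (Real.logb (1 / β) (s * L / (2 * (1 - α)))) 0 + 2⌉ : ℤ) : ℝ) * (cp + 1)
          / (μPL * α * c * cp * K) := by
  have hcs : c ≤ s := hc ▸ min_le_left _ _
  have hc0 : 0 < c := by
    rw [hc]
    exact lt_min hs (div_pos (mul_pos (mul_pos two_pos (sub_pos.2 hα.2)) hβ.1) hL)
  have hP : IsProxOn S r prox := ⟨hprox_mem, fun t ht z w hw =>
    inner_le_of_prox_min hrconv ht (hprox_mem t ht z) hw (hprox_min t ht z)⟩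
  have hgcont : ContinuousOn g S := by
    refine (LipschitzOnWith.of_dist_le_mul (K := L.toNNReal) fun z hz w hw => ?_).continuousOn
    rw [dist_eq_norm, dist_eq_norm, Real.coe_toNNReal _ hL.le]
    exact hglip z hz w hw
  have hxS : ∀ k, ∀ᵐ ω ∂μ, x k ω ∈ S := by
    rintro (_ | k)
    · exact ae_of_all _ fun ω => hx₀det ω ▸ hx₀
    · filter_upwards [hupdate k, htbd k] with ω h1 h2
      exact h1 ▸ hprox_mem _ (hc0.trans_le h2.1) _
  choose x' hx'meas hx'S hx'eq using fun k => exists_stronglyMeasurable_mem hSclosed hx₀ (hxmeas k)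
  have hx'ae : ∀ k, ∀ᵐ ω ∂μ, x' k ω = x k ω := fun k => (hxS k).mono fun ω => hx'eq k ω
  let tprev : ℕ → Ω → ℝ := fun k ω => if k = 0 then s else t (k - 1) ω
  have htprev_meas : ∀ k, Measurable[ℱ k] (tprev k) := by
    rintro (_ | k)
    · exact measurable_const
    · exact (htmeas k).measurable
  have htprev_mem : ∀ k, ∀ᵐ ω ∂μ, c ≤ tprev k ω ∧ tprev k ω ≤ s := by
    rintro (_ | k)
    · exact ae_of_all _ fun ω => ⟨hcs, le_rfl⟩
    · exact htbd k
  let τ : ℕ → Ω → ℝ := fun k ω => max c (min (tprev k ω) s)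
  have hτmem : ∀ k ω, τ k ω ∈ Set.Icc c s := fun k ω =>
    ⟨le_max_left _ _, max_le hcs (min_le_right _ _)⟩
  have hτmeas : ∀ k, Measurable[ℱ k] (τ k) := fun k =>
    Measurable.max measurable_const ((htprev_meas k).min measurable_const)
  let y : ℕ → Ω → EuclideanSpace ℝ (Fin n) := fun k ω =>
    prox (τ k ω) (x' k ω - τ k ω • g (x' k ω))
  have hymeas : ∀ k, StronglyMeasurable[ℱ k] (y k) := fun k =>
    (hP.continuousOn_prox_grad hLr hrlip hgcont hc0).stronglyMeasurable_comp
      ((hτmeas k).prodMk (hx'meas k).measurable) fun ω => ⟨hτmem k ω, hx'S k ω⟩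
  have hyS : ∀ k ω, y k ω ∈ S := fun k ω => hprox_mem _ (hc0.trans_le (hτmem k ω).1) _
  let I : ℕ → Ω → ℝ := fun k ω => if t k ω ≠ tprev k ω then 1 else 0
  have hIint : ∀ k, Integrable (I k) μ := fun k =>
    integrable_ite_ne ((htmeas k).measurable.mono (ℱ.le _) le_rfl)
      ((htprev_meas k).mono (ℱ.le _) le_rfl)
  have hKpos : (0 : ℝ) < K := by exact_mod_cast hK
  have hvar : ∀ k, k < K → σ ^ 2 / N k ≤ σ ^ 2 / (cb * K) := fun k hk => by
    rw [hNdef k hk]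
    exact div_le_div_of_nonneg_left (sq_nonneg _) (by positivity) (Nat.le_ceil _)
  let D : ℕ → Ω → ℝ := fun k ω => ‖(1 / s) • (x k ω - prox s (x k ω - s • g (x k ω)))‖ ^ 2
  have hstep : ∀ k, k < K → α * c / 2 * ∫ ω, D k ω ∂μ
      ≤ ∫ ω, (f (x k ω) + r (x k ω)) ∂μ - ∫ ω, (f (x (k + 1) ω) + r (x (k + 1) ω)) ∂μ
        + (α * c + 3 * L * s ^ 2 + 1 / (2 * L)) * (σ ^ 2 / (cb * K))
        + 3 * L * (s - c) ^ 2 * (Lr + 3 * Bg) ^ 2 * ∫ ω, I k ω ∂μ := by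
    intro k hk
    obtain ⟨hFx, hFx'⟩ := horacle_f k _ (hx'meas k) (hx'S k)
    obtain ⟨hfx, hFfx⟩ := integrable_and_integral_eq_of_condExp_ae_eq (ℱ.le k) hFx'
    obtain ⟨hFy, hFy'⟩ := horacle_f k _ (hymeas k) (hyS k)
    obtain ⟨hfy, hFfy⟩ := integrable_and_integral_eq_of_condExp_ae_eq (ℱ.le k) hFy'
    obtain ⟨hex, hex'⟩ := horacle_var k _ (hx'meas k) (hx'S k)
    obtain ⟨hey, hey'⟩ := horacle_var k _ (hymeas k) (hyS k)
    have hvx := (integral_le_of_ae_condExp_le (ℱ.le k) hex').trans (hvar k hk)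
    have hvy := (integral_le_of_ae_condExp_le (ℱ.le k) hey').trans (hvar k hk)
    have hpt : ∀ᵐ ω ∂μ, f (x (k + 1) ω) + r (x (k + 1) ω) ≤ f (x k ω) + r (x k ω)
        + (F k ω (x' k ω) - f (x' k ω)) + (f (y k ω) - F k ω (y k ω)) - α * c / 2 * D k ω
        + (α * c + 3 * L * s ^ 2) * ‖GF k ω (x' k ω) - g (x' k ω)‖ ^ 2
        + 1 / (2 * L) * ‖GF k ω (y k ω) - g (y k ω)‖ ^ 2
        + 3 * L * (s - c) ^ 2 * (Lr + 3 * Bg) ^ 2 * I k ω := by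
      filter_upwards [hFgrad k, hupdate k, harmijo k hk, htbd k, htprev_mem k, hx'ae k, hxS k]
        with ω h1 h2 h3 h4 h5 h6 h7
      have hτ : τ k ω = tprev k ω := by
        simp only [τ, min_eq_left h5.2, max_eq_right h5.1]
      have hy : y k ω = prox (tprev k ω) (x k ω - tprev k ω • g (x k ω)) := by
        simp only [y, hτ, h6]
      rw [h6]
      exact hP.sampled_armijo_descent hrconv.1 hLr hrlip hL (fun z hz => hf z (hSU hz))
        (fun z hz => h1.1 z (hSU hz)) hglip h1.2 hBg hα.1 hc0 h4.1 h4.2 h5.1 h5.2 h7 h2 hy h3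
    have i1 := hφint k hk.le
    have i2 := i1.add (hFx.sub hfx)
    have i3 := i2.add (hfy.sub hFy)
    have i4 := i3.sub ((hGint k hk).const_mul (α * c / 2))
    have i5 := i4.add (hex.const_mul (α * c + 3 * L * s ^ 2))
    have i6 := i5.add (hey.const_mul (1 / (2 * L)))
    have i7 := i6.add ((hIint k).const_mul (3 * L * (s - c) ^ 2 * (Lr + 3 * Bg) ^ 2))
    have hint := integral_mono_ae (hφint (k + 1) hk) i7 hpt
    rw [integral_add' i6 ((hIint k).const_mul _), integral_add' i5 (hey.const_mul _),
      integral_add' i4 (hex.const_mul _), integral_sub' i3 ((hGint k hk).const_mul _),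
      integral_add' i2 (hfy.sub hFy), integral_add' i1 (hFx.sub hfx), integral_sub' hFx hfx,
      integral_sub' hfy hFy, integral_const_mul, integral_const_mul, integral_const_mul,
      integral_const_mul, hFfx, hFfy] at hint
    have hbx := mul_le_mul_of_nonneg_left hvx
      (by have := hα.1; positivity : 0 ≤ α * c + 3 * L * s ^ 2)
    have hby := mul_le_mul_of_nonneg_left hvy (by positivity : 0 ≤ 1 / (2 * L))
    linarith
  have hIsum : ∑ k ∈ Finset.range K, ∫ ω, I k ω ∂μ ≤ (1 / cp + 1) *
      ((⌈max (Real.logb (1 / β) (s * L / (2 * (1 - α)))) 0 + 2⌉ : ℤ) : ℝ) := by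
    rw [← integral_finsetSum _ fun k _ => hIint k]
    have hle := integral_mono_ae (integrable_finsetSum _ fun k _ => hIint k)
      (integrable_const (μ := μ) ((1 / cp + 1) *
        ((⌈max (Real.logb (1 / β) (s * L / (2 * (1 - α)))) 0 + 2⌉ : ℤ) : ℝ)))
      (hchange.mono fun ω hω => by
        rw [Finset.card_filter] at hω
        push_cast at hω
        simpa [I, tprev] using hω)
    simpa using hle
  have hsum := Finset.sum_le_sum fun k hk => hstep k (Finset.mem_range.1 hk)
  rw [← Finset.mul_sum, Finset.sum_add_distrib, Finset.sum_add_distrib, Finset.sum_range_sub',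
    Finset.sum_const, Finset.card_range, nsmul_eq_mul, ← Finset.mul_sum] at hsum
  have hφ0 : ∫ ω, (f (x 0 ω) + r (x 0 ω)) ∂μ = f x₀ + r x₀ := by simp [hx₀det]
  have hφK : φinf ≤ ∫ ω, (f (x K ω) + r (x K ω)) ∂μ := by
    simpa using integral_mono_ae (integrable_const φinf) (hφint K le_rfl)
      ((hxS K).mono fun ω h => hφinf _ h)
  have hPLsum : μPL * ∑ k ∈ Finset.range K, ∫ ω, (f (x k ω) + r (x k ω) - φinf) ∂μ
      ≤ ∑ k ∈ Finset.range K, ∫ ω, D k ω ∂μ := by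
    rw [Finset.mul_sum]
    refine Finset.sum_le_sum fun k hk => ?_
    have hk := Finset.mem_range.1 hk
    rw [← integral_const_mul]
    exact integral_mono_ae (((hφint k hk.le).sub (integrable_const φinf)).const_mul μPL)
      (hGint k hk) ((hxS k).mono fun ω h => hPL _ h)
  have hα0 := hα.1
  have hcp0 := hcp.1
  set T := ∑ k ∈ Finset.range K, ∫ ω, (f (x k ω) + r (x k ω) - φinf) ∂μ
  set C : ℝ := ((⌈max (Real.logb (1 / β) (s * L / (2 * (1 - α)))) 0 + 2⌉ : ℤ) : ℝ)
  have hfinal : α * c / 2 * (μPL * T) ≤ (f x₀ + r x₀ - φinf)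
      + K * ((α * c + 3 * L * s ^ 2 + 1 / (2 * L)) * (σ ^ 2 / (cb * K)))
      + 3 * L * (s - c) ^ 2 * (Lr + 3 * Bg) ^ 2 * ((1 / cp + 1) * C) := by
    have h1 := mul_le_mul_of_nonneg_left hPLsum (by positivity : 0 ≤ α * c / 2)
    have h2 := mul_le_mul_of_nonneg_left hIsum
      (by positivity : 0 ≤ 3 * L * (s - c) ^ 2 * (Lr + 3 * Bg) ^ 2)
    linarith
  calc 1 / (K : ℝ) * T = 2 / (μPL * α * c * K) * (α * c / 2 * (μPL * T)) := by field_simp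
    _ ≤ 2 / (μPL * α * c * K) * ((f x₀ + r x₀ - φinf)
      + K * ((α * c + 3 * L * s ^ 2 + 1 / (2 * L)) * (σ ^ 2 / (cb * K)))
      + 3 * L * (s - c) ^ 2 * (Lr + 3 * Bg) ^ 2 * ((1 / cp + 1) * C)) :=
        mul_le_mul_of_nonneg_left hfinal (by positivity)
    _ = _ := by field_simp; ring
end
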